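/- arXiv:2203.10312 — 2 statements merged into one kernel-verified Lean document; each statement's English description precedes it below -/
import Mathlib

section
/- Let N ≥ 2, m ∈ ℕ and K : (0,∞) → [0,∞) be continuous. Then every harmonic homogeneous polynomial of degree m belongs to ℋ_m^K(ℝ^N): if h ∈ 𝒫_m(ℝ^N) satisfies Δh = 0, then for every x ∈ ℝ^N and every ε ∈ (0,1), ∫_{{z : ε < |z| < 1/ε}} (h(x) − h(x+z)) K(|z|) dz = 0. Moreover, for m ∈ {0,1} one has ℋ_m^K(ℝ^N) = ℋ_m^1(ℝ^N) = 𝒫_m(ℝ^N). -/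
open MeasureTheory Real Filter Set Topology

noncomputable section

/-- The normalizing constant `c_{N,s}` of the fractional Laplacian. -/
def cns (N : ℕ) (s : ℝ) : ℝ :=
  (2 : ℝ) ^ (2 * s) * Real.pi ^ (-(N : ℝ) / 2) * s *
    Real.Gamma (((N : ℝ) + 2 * s) / 2) / Real.Gamma (1 - s)

/-- The annulus `{z : ε < |z| < 1/ε}` in `ℝ^N`. -/
def annulus (N : ℕ) (ε : ℝ) : Set (EuclideanSpace ℝ (Fin N)) :=
  {z | ε < ‖z‖ ∧ ‖z‖ < 1 / ε}

/-- The truncated fractional-Laplacian integral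
`∫_{ε<|z|<1/ε} (u(x) - u(x+z)) |z|^{-N-2s} dz` (without the normalizing constant). -/
def pvInt (N : ℕ) (s : ℝ) (u : EuclideanSpace ℝ (Fin N) → ℝ)
    (x : EuclideanSpace ℝ (Fin N)) (ε : ℝ) : ℝ :=
  ∫ z in annulus N ε, (u x - u (x + z)) / ‖z‖ ^ ((N : ℝ) + 2 * s)

/-- `u` is `s`-harmonic at `x` in the principal value sense:
`lim_{ε→0⁺} c_{N,s} ∫_{ε<|z|<1/ε} (u(x) - u(x+z)) |z|^{-N-2s} dz = 0`. -/
def SHarmonicAt (N : ℕ) (s : ℝ) (u : EuclideanSpace ℝ (Fin N) → ℝ)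
    (x : EuclideanSpace ℝ (Fin N)) : Prop :=
  Tendsto (fun ε : ℝ => cns N s * pvInt N s u x ε) (𝓝[>] (0 : ℝ)) (𝓝 0)

/-- `u` is (the evaluation of) a homogeneous polynomial of degree `m` on `ℝ^N`. -/
def IsHomPoly (N m : ℕ) (u : EuclideanSpace ℝ (Fin N) → ℝ) : Prop :=
  ∃ P : MvPolynomial (Fin N) ℝ, P.IsHomogeneous m ∧
    ∀ x : EuclideanSpace ℝ (Fin N), u x = MvPolynomial.eval (fun i => x i) P

/-- The Laplacian of `u` at `x`, as the sum of the pure second directional derivatives. -/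
def lap (N : ℕ) (u : EuclideanSpace ℝ (Fin N) → ℝ) (x : EuclideanSpace ℝ (Fin N)) : ℝ :=
  ∑ i : Fin N, iteratedFDeriv ℝ 2 u x ![EuclideanSpace.single i 1, EuclideanSpace.single i 1]

/-- The truncated integral `∫_{ε<|z|<1/ε} (u(x) - u(x+z)) K(|z|) dz` for a general kernel. -/
def pvIntK (N : ℕ) (K : ℝ → ℝ) (u : EuclideanSpace ℝ (Fin N) → ℝ)
    (x : EuclideanSpace ℝ (Fin N)) (ε : ℝ) : ℝ :=
  ∫ z in annulus N ε, (u x - u (x + z)) * K ‖z‖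

/-- `ℋ_m^K(ℝ^N)`: homogeneous polynomials of degree `m` with `ℒ_K u(x) = 0` for all `x`. -/
def HK (N : ℕ) (K : ℝ → ℝ) (m : ℕ) : Set (EuclideanSpace ℝ (Fin N) → ℝ) :=
  {u | IsHomPoly N m u ∧
    ∀ x, Tendsto (fun ε : ℝ => pvIntK N K u x ε) (𝓝[>] (0 : ℝ)) (𝓝 0)}

/-- `ℋ_m^1(ℝ^N)`: harmonic homogeneous polynomials of degree `m`. -/
def H1 (N m : ℕ) : Set (EuclideanSpace ℝ (Fin N) → ℝ) :=
  {u | IsHomPoly N m u ∧ ∀ x, lap N u x = 0}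

/-- `𝒫_m(ℝ^N)`: homogeneous polynomials of degree `m`. -/
def Pm (N m : ℕ) : Set (EuclideanSpace ℝ (Fin N) → ℝ) :=
  {u | IsHomPoly N m u}

lemma IsHomPoly.contDiff {N m : ℕ} {u : EuclideanSpace ℝ (Fin N) → ℝ} (hu : IsHomPoly N m u)
    (n : WithTop ℕ∞) : ContDiff ℝ n u := by
  obtain ⟨P, -, hP⟩ := hu
  rw [show u = fun x => MvPolynomial.eval (fun i => x i) P from funext hP]
  clear hP
  induction P using MvPolynomial.induction_on with
  | C a => simpa using contDiff_const
  | add p q hp hq => simpa using hp.add hq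
  | mul_X p i hp =>
    simp only [map_mul, MvPolynomial.eval_X]
    exact hp.mul (by fun_prop)

lemma IsHomPoly.map_smul {N m : ℕ} {u : EuclideanSpace ℝ (Fin N) → ℝ} (hu : IsHomPoly N m u)
    (t : ℝ) (x : EuclideanSpace ℝ (Fin N)) : u (t • x) = t ^ m * u x := by
  obtain ⟨P, hhom, hP⟩ := hu
  rw [hP, hP, MvPolynomial.eval_eq', MvPolynomial.eval_eq', Finset.mul_sum]
  refine Finset.sum_congr rfl fun d hd => ?_
  have hdeg : ∑ i, d i = m := by
    rw [← Finsupp.degree_eq_sum]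
    by_contra hne
    exact MvPolynomial.mem_support_iff.1 hd (hhom.coeff_eq_zero hne)
  simp only [PiLp.smul_apply, smul_eq_mul, mul_pow, Finset.prod_mul_distrib,
    Finset.prod_pow_eq_pow_sum, hdeg]
  ring

lemma IsHomPoly.fderiv_const {N m : ℕ} {u : EuclideanSpace ℝ (Fin N) → ℝ}
    (hu : IsHomPoly N m u) (hm : m = 0 ∨ m = 1) :
    ∃ L : EuclideanSpace ℝ (Fin N) →L[ℝ] ℝ, fderiv ℝ u = fun _ => L := by
  rcases hm with rfl | rfl
  · refine ⟨0, funext fun x => ?_⟩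
    have h : u = fun _ => u 0 := by
      funext y
      simpa using (hu.map_smul 0 y).symm
    rw [h]
    simp
  · have hd : HasFDerivAt u (fderiv ℝ u 0) 0 :=
      ((hu.contDiff 1).differentiable one_ne_zero 0).hasFDerivAt
    have h : u = fderiv ℝ u 0 := by
      funext y
      have h0 : HasFDerivAt u (fderiv ℝ u 0) ((0 : ℝ) • y) := by simpa using hd
      have h1 : HasDerivAt (fun t : ℝ => u (t • y)) (fderiv ℝ u 0 ((1 : ℝ) • y)) 0 :=
        h0.comp_hasDerivAt (0 : ℝ) ((hasDerivAt_id (0 : ℝ)).smul_const y)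
      have h2 : HasDerivAt (fun t : ℝ => u (t • y)) (u y) 0 := by
        simpa [hu.map_smul] using (hasDerivAt_id (0 : ℝ)).mul_const (u y)
      simpa using h2.unique h1
    refine ⟨fderiv ℝ u 0, funext fun x => ?_⟩
    conv_lhs => rw [h]
    exact ContinuousLinearMap.fderiv _

lemma IsHomPoly.lap_eq_zero {N m : ℕ} {u : EuclideanSpace ℝ (Fin N) → ℝ}
    (hu : IsHomPoly N m u) (hm : m = 0 ∨ m = 1) (x : EuclideanSpace ℝ (Fin N)) :
    lap N u x = 0 := by
  obtain ⟨L, hL⟩ := hu.fderiv_const hm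
  simp [lap, iteratedFDeriv_two_apply, hL]

lemma hasFDerivAt_radial_primitive {E : Type*} [NormedAddCommGroup E] [InnerProductSpace ℝ E]
    {G : ℝ → ℝ} (hG : Continuous G) (R : ℝ) (z : E) :
    HasFDerivAt (fun z : E => ∫ s in (‖z‖ ^ 2)..(R ^ 2), G s)
      ((-G (‖z‖ ^ 2)) • ((2 : ℝ) • innerSL ℝ z)) z := by
  have h1 : HasDerivAt (fun t => ∫ s in t..(R ^ 2), G s) (-G (‖z‖ ^ 2)) (‖z‖ ^ 2) :=
    intervalIntegral.integral_hasDerivAt_left (hG.intervalIntegrable _ _)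
      hG.stronglyMeasurable.stronglyMeasurableAtFilter hG.continuousAt
  have h2 : HasFDerivAt (fun z : E => ‖z‖ ^ 2) ((2 : ℝ) • innerSL ℝ z) z := by
    simpa only [ofNat_smul_eq_nsmul] using (hasStrictFDerivAt_norm_sq z).hasFDerivAt
  exact h1.comp_hasFDerivAt z h2

/-- Integration by parts against a radial weight `G (‖z‖ ^ 2)`, with the radial primitive of the
weight appearing on the right. -/
lemma integral_mul_inner_radial {E : Type*} [NormedAddCommGroup E] [InnerProductSpace ℝ E]
    [FiniteDimensional ℝ E] [MeasurableSpace E] [BorelSpace E]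
    {G : ℝ → ℝ} (hG : Continuous G) {R : ℝ} (hR : 0 ≤ R) (hGR : ∀ t, R ^ 2 ≤ t → G t = 0)
    {f : E → ℝ} (hf : ContDiff ℝ 1 f) (v : E) :
    2 * ∫ z, f z * (inner ℝ z v * G (‖z‖ ^ 2)) =
      ∫ z, fderiv ℝ f z v * ∫ s in (‖z‖ ^ 2)..(R ^ 2), G s := by
  set ψ : E → ℝ := fun z => ∫ s in (‖z‖ ^ 2)..(R ^ 2), G s with hψ
  have hder : ∀ z, HasFDerivAt ψ ((-G (‖z‖ ^ 2)) • ((2 : ℝ) • innerSL ℝ z)) z :=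
    hasFDerivAt_radial_primitive hG R
  have hdiff : Differentiable ℝ ψ := fun z => (hder z).differentiableAt
  have hsupp : HasCompactSupport ψ := by
    refine HasCompactSupport.intro (isCompact_closedBall (0 : E) R) fun z hz => ?_
    have hz' : R ^ 2 ≤ ‖z‖ ^ 2 := by
      have : R < ‖z‖ := by simpa using hz
      gcongr
    refine intervalIntegral.integral_zero_ae (ae_of_all _ fun s hs => hGR s ?_)
    rw [uIoc_of_ge hz'] at hs
    exact hs.1.le
  have hfd : ∀ z, fderiv ℝ ψ z v = -2 * (inner ℝ z v * G (‖z‖ ^ 2)) := by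
    intro z
    rw [(hder z).fderiv]
    simp
    ring
  have hfdc : Continuous fun z => fderiv ℝ ψ z v := by
    simp only [hfd]
    fun_prop
  have hfc : Continuous fun z => fderiv ℝ f z v :=
    (hf.continuous_fderiv one_ne_zero).clm_apply continuous_const
  have hfdsupp : HasCompactSupport fun z => fderiv ℝ ψ z v := hsupp.fderiv_apply ℝ v
  have key := integral_mul_fderiv_eq_neg_fderiv_mul_of_integrable (μ := (volume : Measure E))
    (f := f) (g := ψ) (v := v)
    ((hfc.mul hdiff.continuous).integrable_of_hasCompactSupport hsupp.mul_left)
    ((hf.continuous.mul hfdc).integrable_of_hasCompactSupport hfdsupp.mul_left)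
    ((hf.continuous.mul hdiff.continuous).integrable_of_hasCompactSupport hsupp.mul_left)
    (fun z _ => hf.differentiable one_ne_zero z) (fun z _ => hdiff z)
  rw [← neg_eq_iff_eq_neg] at key
  rw [← key, ← integral_const_mul, ← integral_neg]
  refine integral_congr_ae (ae_of_all _ fun z => ?_)
  simp only [hfd]
  ring

lemma hasDerivAt_integral_comp_smul_mul {E : Type*} [NormedAddCommGroup E] [NormedSpace ℝ E]
    [FiniteDimensional ℝ E] [MeasurableSpace E] [BorelSpace E] {μ : Measure E}
    [IsFiniteMeasureOnCompacts μ] {w : E → ℝ} (hw : Continuous w) (hws : HasCompactSupport w)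
    {u : E → ℝ} (hu : ContDiff ℝ 1 u) (x : E) (t : ℝ) :
    HasDerivAt (fun t : ℝ => ∫ z, u (x + t • z) * w z ∂μ)
      (∫ z, fderiv ℝ u (x + t • z) z * w z ∂μ) t := by
  have hc : Continuous fun p : ℝ × E => fderiv ℝ u (x + p.1 • p.2) p.2 * w p.2 :=
    (((hu.continuous_fderiv one_ne_zero).comp (by fun_prop)).clm_apply continuous_snd).mul
      (hw.comp continuous_snd)
  obtain ⟨C, hC⟩ := ((isCompact_closedBall t 1).prod hws.isCompact).exists_bound_of_continuousOn
    hc.continuousOn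
  have huc := hu.continuous
  refine (hasDerivAt_integral_of_dominated_loc_of_deriv_le
    (F := fun t z => u (x + t • z) * w z)
    (F' := fun t z => fderiv ℝ u (x + t • z) z * w z)
    (bound := (tsupport w).indicator fun _ => C)
    (Metric.closedBall_mem_nhds t one_pos) ?_ ?_ ?_ ?_ ?_ ?_).2
  · exact Eventually.of_forall fun s =>
      Continuous.aestronglyMeasurable (by fun_prop)
  · exact Continuous.integrable_of_hasCompactSupport (by fun_prop) hws.mul_left
  · exact (hc.comp (Continuous.prodMk_right t)).aestronglyMeasurable
  · refine ae_of_all _ fun z s hs => ?_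
    by_cases hz : z ∈ tsupport w
    · rw [indicator_of_mem hz]
      exact hC (s, z) ⟨hs, hz⟩
    · simp [indicator_of_notMem hz, image_eq_zero_of_notMem_tsupport hz]
  · exact (integrable_indicator_iff (isClosed_tsupport w).measurableSet).2
      (integrableOn_const hws.isCompact.measure_lt_top.ne)
  · refine ae_of_all _ fun z s _ => ?_
    have h1 : HasDerivAt (fun s : ℝ => x + s • z) z s := by
      simpa using ((hasDerivAt_id s).smul_const z).const_add x
    exact ((hu.differentiable one_ne_zero _).hasFDerivAt.comp_hasDerivAt s h1).mul_const _

/-- The mean value property of harmonic functions for a continuous compactly supported radial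
weight. -/
lemma integral_sub_mul_radial_eq_zero {N : ℕ} {u : EuclideanSpace ℝ (Fin N) → ℝ}
    (hu : ContDiff ℝ 2 u) (hlap : ∀ x, lap N u x = 0) {G : ℝ → ℝ} (hG : Continuous G) {R : ℝ}
    (hR : 0 ≤ R) (hGR : ∀ t, R ^ 2 ≤ t → G t = 0) (x : EuclideanSpace ℝ (Fin N)) :
    ∫ z, (u x - u (x + z)) * G (‖z‖ ^ 2) = 0 := by
  have hu1 : ContDiff ℝ 1 u := hu.of_le one_le_two
  have huc := hu.continuous
  have hdu : ContDiff ℝ 1 (fderiv ℝ u) := hu.fderiv_right (by norm_num)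
  have hduc := hdu.continuous
  have hw : Continuous fun z : EuclideanSpace ℝ (Fin N) => G (‖z‖ ^ 2) := by fun_prop
  have hws : HasCompactSupport fun z : EuclideanSpace ℝ (Fin N) => G (‖z‖ ^ 2) := by
    refine HasCompactSupport.intro (isCompact_closedBall 0 R) fun z hz => hGR _ ?_
    have : R < ‖z‖ := by simpa using hz
    gcongr
  have hψc : Continuous fun z : EuclideanSpace ℝ (Fin N) => ∫ s in (‖z‖ ^ 2)..(R ^ 2), G s :=
    continuous_iff_continuousAt.2 fun z => (hasFDerivAt_radial_primitive hG R z).continuousAt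
  have hψs : HasCompactSupport
      fun z : EuclideanSpace ℝ (Fin N) => ∫ s in (‖z‖ ^ 2)..(R ^ 2), G s := by
    refine HasCompactSupport.intro (isCompact_closedBall 0 R) fun z hz => ?_
    have hz' : R ^ 2 ≤ ‖z‖ ^ 2 := by
      have : R < ‖z‖ := by simpa using hz
      gcongr
    refine intervalIntegral.integral_zero_ae (ae_of_all _ fun s hs => hGR s ?_)
    rw [uIoc_of_ge hz'] at hs
    exact hs.1.le
  have hderiv : ∀ t : ℝ, ∫ z, fderiv ℝ u (x + t • z) z * G (‖z‖ ^ 2) = 0 := by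
    intro t
    set e : Fin N → EuclideanSpace ℝ (Fin N) := fun i => EuclideanSpace.single i 1 with he
    have hexp : ∀ z : EuclideanSpace ℝ (Fin N), fderiv ℝ u (x + t • z) z * G (‖z‖ ^ 2) =
        ∑ i, fderiv ℝ u (x + t • z) (e i) * (inner ℝ z (e i) * G (‖z‖ ^ 2)) := by
      intro z
      have hz : z = ∑ i, inner ℝ z (e i) • e i := by
        ext j
        simp [he, EuclideanSpace.inner_single_right, Pi.single_apply]
      have hz' := congrArg (fderiv ℝ u (x + t • z)) hz
      rw [map_sum] at hz'
      rw [hz', Finset.sum_mul]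
      refine Finset.sum_congr rfl fun i _ => ?_
      rw [map_smul, smul_eq_mul]
      ring
    have hfi : ∀ i, ContDiff ℝ 1 fun z => fderiv ℝ u (x + t • z) (e i) := fun i =>
      (hdu.comp (by fun_prop)).clm_apply contDiff_const
    have hfd : ∀ i z, fderiv ℝ (fun z => fderiv ℝ u (x + t • z) (e i)) z (e i) =
        t * fderiv ℝ (fderiv ℝ u) (x + t • z) (e i) (e i) := by
      intro i z
      have h1 : HasFDerivAt (fun z => x + t • z)
          (t • ContinuousLinearMap.id ℝ (EuclideanSpace ℝ (Fin N))) z :=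
        ((hasFDerivAt_id z).const_smul t).const_add x
      have h2 := (((hdu.differentiable one_ne_zero (x + t • z)).hasFDerivAt.comp z h1).clm_apply
        (hasFDerivAt_const (e i) z)).fderiv
      rw [show (fun z => fderiv ℝ u (x + t • z) (e i)) =
        fun z => (fderiv ℝ u ∘ fun z => x + t • z) z (e i) from rfl, h2]
      simp
    have hibp := fun i => integral_mul_inner_radial hG hR hGR (hfi i) (e i)
    have hsum : 2 * ∫ z, fderiv ℝ u (x + t • z) z * G (‖z‖ ^ 2) = 0 := by
      simp only [hexp]
      rw [integral_finsetSum, Finset.mul_sum, Finset.sum_congr rfl fun i _ => hibp i,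
        ← integral_finsetSum]
      · refine integral_eq_zero_of_ae (ae_of_all _ fun z => ?_)
        simp only [hfd, Pi.zero_apply]
        have := hlap (x + t • z)
        simp only [lap, iteratedFDeriv_two_apply] at this
        rw [← Finset.sum_mul, ← Finset.mul_sum]
        simp [he] at this ⊢
        simp [this]
      · intro i _
        refine Continuous.integrable_of_hasCompactSupport ?_ hψs.mul_left
        exact (((hfi i).continuous_fderiv one_ne_zero).clm_apply continuous_const).mul hψc
      · intro i _
        refine Continuous.integrable_of_hasCompactSupport ?_ (hws.mul_left.mul_left)
        have := (hfi i).continuous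
        fun_prop
    simpa using hsum
  have hconst := is_const_of_deriv_eq_zero
    (fun t => (hasDerivAt_integral_comp_smul_mul (μ := volume) hw hws hu1 x t).differentiableAt)
    (fun t => (hasDerivAt_integral_comp_smul_mul (μ := volume) hw hws hu1 x t).deriv.trans
      (hderiv t)) 0 1
  simp only [zero_smul, add_zero, one_smul] at hconst
  simp only [sub_mul]
  rw [integral_sub, hconst, sub_self]
  · exact Continuous.integrable_of_hasCompactSupport (by fun_prop) hws.mul_left
  · exact Continuous.integrable_of_hasCompactSupport (by fun_prop) hws.mul_left

/-- A continuous cutoff increasing with `n` to the indicator of the interval `(a, b)`. -/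
def intervalCutoff (a b : ℝ) (n : ℕ) (r : ℝ) : ℝ :=
  min 1 (n * max 0 (min (r - a) (b - r)))

lemma intervalCutoff_nonneg (a b : ℝ) (n : ℕ) (r : ℝ) : 0 ≤ intervalCutoff a b n r := by
  unfold intervalCutoff
  positivity

lemma intervalCutoff_le_one (a b : ℝ) (n : ℕ) (r : ℝ) : intervalCutoff a b n r ≤ 1 :=
  min_le_left _ _

lemma continuous_intervalCutoff (a b : ℝ) (n : ℕ) : Continuous (intervalCutoff a b n) := by
  unfold intervalCutoff
  fun_prop

lemma intervalCutoff_eq_zero {a b r : ℝ} (hr : r ∉ Ioo a b) (n : ℕ) :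
    intervalCutoff a b n r = 0 := by
  have h : min (r - a) (b - r) ≤ 0 := by
    by_contra! h
    rw [lt_min_iff] at h
    exact hr ⟨by linarith [h.1], by linarith [h.2]⟩
  simp [intervalCutoff, max_eq_left h]

lemma tendsto_intervalCutoff {a b r : ℝ} (hr : r ∈ Ioo a b) :
    Tendsto (fun n => intervalCutoff a b n r) atTop (𝓝 1) := by
  have h : 0 < max 0 (min (r - a) (b - r)) :=
    lt_max_of_lt_right (lt_min (sub_pos.2 hr.1) (sub_pos.2 hr.2))
  refine tendsto_const_nhds.congr' ?_
  filter_upwards [(tendsto_natCast_atTop_atTop.atTop_mul_const h).eventually_ge_atTop 1]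
    with n hn
  exact (min_eq_left hn).symm

lemma pvIntK_eq_zero {N : ℕ} {K : ℝ → ℝ} (hK : ContinuousOn K (Ioi 0))
    {u : EuclideanSpace ℝ (Fin N) → ℝ} (hu : ContDiff ℝ 2 u) (hlap : ∀ x, lap N u x = 0)
    (x : EuclideanSpace ℝ (Fin N)) {ε : ℝ} (hε : 0 < ε) : pvIntK N K u x ε = 0 := by
  set k : ℝ → ℝ := fun r => K (max r ε) with hk
  have hkc : Continuous k := hK.comp_continuous (by fun_prop) fun r => lt_max_of_lt_right hε
  have huc := hu.continuous
  set g : EuclideanSpace ℝ (Fin N) → ℝ := fun z => (u x - u (x + z)) * k ‖z‖ with hg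
  have hgc : Continuous g := by fun_prop
  have hR : 0 ≤ 1 / ε := by positivity
  have hann : MeasurableSet (annulus N ε) :=
    (measurableSet_lt measurable_const measurable_norm).inter
      (measurableSet_lt measurable_norm measurable_const)
  have hzero : ∀ n : ℕ, ∫ z, intervalCutoff ε (1 / ε) n ‖z‖ * g z = 0 := by
    intro n
    have hcut := continuous_intervalCutoff ε (1 / ε) n
    have := integral_sub_mul_radial_eq_zero hu hlap
      (G := fun t => intervalCutoff ε (1 / ε) n (√t) * k (√t)) (by fun_prop) hR
      (fun t ht => by
        rw [intervalCutoff_eq_zero, zero_mul]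
        exact fun h => (Real.le_sqrt_of_sq_le ht).not_gt h.2) x
    rw [← this]
    refine integral_congr_ae (ae_of_all _ fun z => ?_)
    simp only [hg, Real.sqrt_sq (norm_nonneg z)]
    ring
  have hlim : Tendsto (fun n : ℕ => ∫ z, intervalCutoff ε (1 / ε) n ‖z‖ * g z) atTop
      (𝓝 (∫ z, (annulus N ε).indicator g z)) := by
    refine tendsto_integral_of_dominated_convergence
      ((Metric.closedBall 0 (1 / ε)).indicator fun z => ‖g z‖) ?_ ?_ ?_ ?_
    · intro n
      have hcut := continuous_intervalCutoff ε (1 / ε) n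
      exact Continuous.aestronglyMeasurable (by fun_prop)
    · exact (integrable_indicator_iff Metric.isClosed_closedBall.measurableSet).2
        (hgc.norm.continuousOn.integrableOn_compact (isCompact_closedBall _ _))
    · refine fun n => ae_of_all _ fun z => ?_
      by_cases hz : z ∈ Metric.closedBall 0 (1 / ε)
      · rw [indicator_of_mem hz, norm_mul, Real.norm_of_nonneg (intervalCutoff_nonneg _ _ _ _)]
        exact mul_le_of_le_one_left (norm_nonneg _) (intervalCutoff_le_one _ _ _ _)
      · rw [indicator_of_notMem hz, intervalCutoff_eq_zero, zero_mul, norm_zero]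
        exact fun h => hz (by simpa using h.2.le)
    · refine ae_of_all _ fun z => ?_
      by_cases hz : z ∈ annulus N ε
      · rw [indicator_of_mem hz]
        simpa using (tendsto_intervalCutoff (r := ‖z‖) hz).mul_const (g z)
      · rw [indicator_of_notMem hz]
        refine tendsto_const_nhds.congr fun n => ?_
        rw [intervalCutoff_eq_zero (fun h => hz h), zero_mul]
  simp only [hzero] at hlim
  rw [integral_indicator hann] at hlim
  rw [pvIntK, tendsto_nhds_unique tendsto_const_nhds hlim]
  refine setIntegral_congr_fun hann fun z hz => ?_
  simp only [hg, hk, max_eq_left hz.1.le]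

/-- For a continuous nonnegative kernel `K` on `(0,∞)`: every harmonic homogeneous polynomial
of degree `m` has all its truncated `K`-integrals equal to `0` (hence belongs to
`ℋ_m^K(ℝ^N)`); moreover for `m ∈ {0,1}`, `ℋ_m^K(ℝ^N) = ℋ_m^1(ℝ^N) = 𝒫_m(ℝ^N)`. -/
theorem harmonic_poly_mem_HK
    (N : ℕ) (hN : 2 ≤ N) (m : ℕ) (K : ℝ → ℝ)
    (hK : ContinuousOn K (Ioi 0)) (hKpos : ∀ t ∈ Ioi (0 : ℝ), 0 ≤ K t) :
    (∀ h ∈ H1 N m, ∀ x : EuclideanSpace ℝ (Fin N), ∀ ε ∈ Ioo (0 : ℝ) 1,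
        pvIntK N K h x ε = 0) ∧
    (m = 0 ∨ m = 1 → HK N K m = H1 N m ∧ H1 N m = Pm N m) := by
  have hzero : ∀ h ∈ H1 N m, ∀ x : EuclideanSpace ℝ (Fin N), ∀ ε : ℝ, 0 < ε →
      pvIntK N K h x ε = 0 :=
    fun h hh x ε hε => pvIntK_eq_zero hK (hh.1.contDiff 2) hh.2 x hε
  refine ⟨fun h hh x ε hε => hzero h hh x ε hε.1, fun hm => ?_⟩
  have hP : Pm N m ⊆ H1 N m := fun u hu => ⟨hu, hu.lap_eq_zero hm⟩
  refine ⟨Subset.antisymm (fun u hu => hP hu.1) fun u hu => ⟨hu.1, fun x => ?_⟩,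
    Subset.antisymm (fun u hu => hu.1) hP⟩
  refine tendsto_const_nhds.congr' ?_
  filter_upwards [self_mem_nhdsWithin] with ε hε
  exact (hzero u hu x ε hε).symm
end
end

section
/- Let N ≥ 2, m ∈ ℕ with m ≥ 2, and K : (0,∞) → [0,∞) be continuous with ∫_0^{+∞} K(t) t^{N−1+i} dt ∈ (0,+∞] for every i ∈ {2,…,m}. Suppose that lim_{ε→0^+} κ_{i,j}(ε) = 0 for all i, j ∈ {2,…,m} with i > j, where κ_{i,j}(ε) = (∫_ε^{1/ε} K(t) t^{N−1+j} dt)/(∫_ε^{1/ε} K(t) t^{N−1+i} dt). Then ℋ_m^K(ℝ^N) = ℋ_m^1(ℝ^N). -/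
open MeasureTheory Real Filter Set Topology

noncomputable section

namespace MvPolynomial

variable {σ : Type*}

/-- The algebraic Laplacian. -/
def laplacian [Fintype σ] (P : MvPolynomial σ ℝ) : MvPolynomial σ ℝ :=
  ∑ i, pderiv i (pderiv i P)

/-- The translate `P(x + ·)` of a polynomial. -/
def translate (x : σ → ℝ) : MvPolynomial σ ℝ →ₐ[ℝ] MvPolynomial σ ℝ :=
  aeval fun i => X i + C (x i)

theorem eval_translate (x z : σ → ℝ) (P : MvPolynomial σ ℝ) :
    eval z (translate x P) = eval (x + z) P := by
  induction P using MvPolynomial.induction_on with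
  | C a => simp [translate]
  | add p q hp hq => simp [hp, hq]
  | mul_X p i hp =>
    rw [map_mul, map_mul, map_mul, hp]
    simp [translate, add_comm]

theorem coeff_zero_translate (x : σ → ℝ) (P : MvPolynomial σ ℝ) :
    coeff 0 (translate x P) = eval x P := by
  have h := eval_translate x 0 P
  rwa [add_zero, eval_zero, constantCoeff_eq] at h

theorem pderiv_translate (x : σ → ℝ) (i : σ) (P : MvPolynomial σ ℝ) :
    pderiv i (translate x P) = translate x (pderiv i P) := by
  classical
  induction P using MvPolynomial.induction_on with
  | C a => simp [translate]
  | add p q hp hq => simp [hp, hq]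
  | mul_X p j hp =>
    rw [map_mul, pderiv_mul, hp, pderiv_mul, map_add, map_mul, map_mul]
    congr 2
    by_cases h : j = i
    · subst h; simp [translate]
    · simp [translate, pderiv_X_of_ne h]

theorem laplacian_translate [Fintype σ] (x : σ → ℝ) (P : MvPolynomial σ ℝ) :
    laplacian (translate x P) = translate x (laplacian P) := by
  simp [laplacian, pderiv_translate]

theorem totalDegree_translate_le (x : σ → ℝ) (P : MvPolynomial σ ℝ) :
    (translate x P).totalDegree ≤ P.totalDegree := by
  rw [translate, aeval_def, eval₂_eq]
  refine totalDegree_finsetSum_le fun d hd => ?_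
  refine (totalDegree_mul _ _).trans ?_
  rw [algebraMap_eq, totalDegree_C, zero_add]
  refine (totalDegree_finsetProd _ _).trans ?_
  refine le_trans (Finset.sum_le_sum fun i _ => ?_) (le_totalDegree hd)
  refine (totalDegree_pow _ _).trans ?_
  have h : (X i + C (x i) : MvPolynomial σ ℝ).totalDegree ≤ 1 :=
    (totalDegree_add _ _).trans (by simp)
  simpa using Nat.mul_le_mul_left (d i) h

theorem homogeneousComponent_pderiv (k : ℕ) (i : σ) (P : MvPolynomial σ ℝ) :
    homogeneousComponent k (pderiv i P) = pderiv i (homogeneousComponent (k + 1) P) := by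
  ext d
  rw [coeff_homogeneousComponent, coeff_pderiv, coeff_pderiv, coeff_homogeneousComponent]
  simp [map_add, Finsupp.degree_single]

theorem homogeneousComponent_laplacian [Fintype σ] (k : ℕ) (P : MvPolynomial σ ℝ) :
    homogeneousComponent k (laplacian P) = laplacian (homogeneousComponent (k + 2) P) := by
  simp [laplacian, homogeneousComponent_pderiv]

theorem IsHomogeneous.laplacian_eq_zero [Fintype σ] {P : MvPolynomial σ ℝ}
    (hP : P.IsHomogeneous 1) : laplacian P = 0 := by
  refine Finset.sum_eq_zero fun i _ => ?_
  have h : (pderiv i P).IsHomogeneous 0 := hP.pderiv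
  rw [← totalDegree_zero_iff_isHomogeneous, totalDegree_eq_zero_iff_eq_C] at h
  rw [h, pderiv_C]

variable {N : ℕ}

theorem hasFDerivAt_eval (P : MvPolynomial (Fin N) ℝ) (x : EuclideanSpace ℝ (Fin N)) :
    HasFDerivAt (fun y : EuclideanSpace ℝ (Fin N) => eval (fun i => y i) P)
      (∑ i, eval (fun i => x i) (pderiv i P) • EuclideanSpace.proj (𝕜 := ℝ) i) x := by
  induction P using MvPolynomial.induction_on with
  | C a => simpa using hasFDerivAt_const a x
  | add p q hp hq =>
    simp only [map_add, add_smul, Finset.sum_add_distrib]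
    exact hp.add hq
  | mul_X p j hp =>
    have hj : HasFDerivAt (fun y : EuclideanSpace ℝ (Fin N) => y j)
        (EuclideanSpace.proj (𝕜 := ℝ) j : EuclideanSpace ℝ (Fin N) →L[ℝ] ℝ) x :=
      (EuclideanSpace.proj (𝕜 := ℝ) j : EuclideanSpace ℝ (Fin N) →L[ℝ] ℝ).hasFDerivAt
    simp only [map_mul, eval_X]
    refine (hp.mul hj).congr_fderiv ?_
    ext v
    simp [pderiv_X, Pi.single_apply, Finset.mul_sum, mul_add, Finset.sum_add_distrib, apply_ite,
      mul_comm, mul_left_comm]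

theorem fderiv_eval_single (P : MvPolynomial (Fin N) ℝ) (x : EuclideanSpace ℝ (Fin N))
    (i : Fin N) :
    fderiv ℝ (fun y : EuclideanSpace ℝ (Fin N) => eval (fun i => y i) P) x
      (EuclideanSpace.single i 1) = eval (fun i => x i) (pderiv i P) := by
  rw [(hasFDerivAt_eval P x).fderiv]
  simp

theorem contDiff_eval_euclidean {n : WithTop ℕ∞} (P : MvPolynomial (Fin N) ℝ) :
    ContDiff ℝ n fun y : EuclideanSpace ℝ (Fin N) => eval (fun i => y i) P := by
  induction P using MvPolynomial.induction_on with
  | C a => simpa using contDiff_const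
  | add p q hp hq => simpa using hp.add hq
  | mul_X p j hp => simpa using hp.mul (by fun_prop)

theorem continuous_eval_euclidean (P : MvPolynomial (Fin N) ℝ) :
    Continuous fun y : EuclideanSpace ℝ (Fin N) => eval (fun i => y i) P :=
  (contDiff_eval_euclidean P (n := 0)).continuous

theorem lap_eval (P : MvPolynomial (Fin N) ℝ) (x : EuclideanSpace ℝ (Fin N)) :
    lap N (fun y => eval (fun i => y i) P) x = eval (fun i => x i) (laplacian P) := by
  rw [lap, laplacian, map_sum]
  refine Finset.sum_congr rfl fun i _ => ?_
  have hd : DifferentiableAt ℝ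
      (fderiv ℝ (fun y : EuclideanSpace ℝ (Fin N) => eval (fun i => y i) P)) x :=
    ((contDiff_eval_euclidean P (n := 2)).fderiv_right (m := 1) le_rfl).differentiable
      one_ne_zero x
  have hi : HasFDerivAt (fun y : EuclideanSpace ℝ (Fin N) => eval (fun i => y i) (pderiv i P))
      _ x := (hd.hasFDerivAt.clm_apply
        (hasFDerivAt_const (EuclideanSpace.single i (1 : ℝ)) x)).congr_of_eventuallyEq
      (Eventually.of_forall fun y => (fderiv_eval_single P y i).symm)
  rw [iteratedFDeriv_two_apply, ← fderiv_eval_single (pderiv i P) x i, hi.fderiv]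
  simp

theorem IsHomogeneous.eval_smul {P : MvPolynomial σ ℝ} {k : ℕ} (hP : P.IsHomogeneous k)
    (t : ℝ) (x : σ → ℝ) : eval (fun i => t * x i) P = t ^ k * eval x P := by
  rw [eval_eq, eval_eq, Finset.mul_sum]
  refine Finset.sum_congr rfl fun d hd => ?_
  have hk : d.degree = k := by
    rw [Finsupp.degree_eq_weight_one]
    exact hP (mem_support_iff.1 hd)
  rw [← hk, Finsupp.degree_apply]
  simp only [mul_pow, Finset.prod_mul_distrib, Finset.prod_pow_eq_pow_sum]
  ring

end MvPolynomial

namespace MvPolynomial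

variable {N : ℕ}

/-- The integral of a polynomial over the unit sphere. -/
def sphereIntegral (P : MvPolynomial (Fin N) ℝ) : ℝ :=
  ∫ θ : Metric.sphere (0 : EuclideanSpace ℝ (Fin N)) 1,
    eval (fun i => (θ : EuclideanSpace ℝ (Fin N)) i) P
      ∂(volume : Measure (EuclideanSpace ℝ (Fin N))).toSphere

theorem IsHomogeneous.integral_eval_mul_norm (hN : N ≠ 0) {P : MvPolynomial (Fin N) ℝ} {k : ℕ}
    (hP : P.IsHomogeneous k) (f : ℝ → ℝ) :
    ∫ z : EuclideanSpace ℝ (Fin N), eval (fun i => z i) P * f ‖z‖ =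
      sphereIntegral P * ∫ t in Ioi (0 : ℝ), f t * t ^ (N - 1 + k) := by
  have : Nonempty (Fin N) := Fin.pos_iff_nonempty.1 (Nat.pos_of_ne_zero hN)
  let μ : Measure (EuclideanSpace ℝ (Fin N)) := volume
  have hdim : Module.finrank ℝ (EuclideanSpace ℝ (Fin N)) = N := by simp
  calc
    ∫ z : EuclideanSpace ℝ (Fin N), eval (fun i => z i) P * f ‖z‖
      = ∫ z : ({(0)}ᶜ : Set (EuclideanSpace ℝ (Fin N))),
          eval (fun i => z.1 i) P * f ‖z.1‖ ∂(μ.comap (↑)) := by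
      rw [integral_subtype_comap (measurableSet_singleton _).compl
        fun z : EuclideanSpace ℝ (Fin N) => eval (fun i => z i) P * f ‖z‖,
        restrict_compl_singleton]
    _ = ∫ y, eval (fun i => y.1.1 i) P * (y.2.1 ^ k * f y.2.1)
          ∂μ.toSphere.prod (.volumeIoiPow (N - 1)) := by
      have h := μ.measurePreserving_homeomorphUnitSphereProd.integral_comp
        (Homeomorph.measurableEmbedding _)
        (fun y => eval (fun i => y.1.1 i) P * (y.2.1 ^ k * f y.2.1))
      rw [hdim] at h
      rw [← h]
      refine integral_congr_ae (Eventually.of_forall fun z => ?_)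
      have hz : ‖z.1‖ ≠ 0 := norm_ne_zero_iff.2 z.2
      have hs := hP.eval_smul ‖z.1‖⁻¹ (fun i => z.1 i)
      simp only [homeomorphUnitSphereProd_apply_snd_coe, homeomorphUnitSphereProd_apply_fst_coe,
        PiLp.smul_apply, smul_eq_mul, hs]
      rw [inv_pow]
      field_simp
    _ = sphereIntegral P * ∫ t : Ioi (0 : ℝ), t.1 ^ k * f t ∂.volumeIoiPow (N - 1) :=
      integral_prod_mul (fun θ : Metric.sphere (0 : EuclideanSpace ℝ (Fin N)) 1 =>
        eval (fun i => θ.1 i) P) (fun t : Ioi (0 : ℝ) => t.1 ^ k * f t)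
    _ = _ := by
      congr 1
      simp only [Measure.volumeIoiPow, ENNReal.ofReal]
      rw [integral_withDensity_eq_integral_smul,
        integral_subtype_comap measurableSet_Ioi
          fun a : ℝ => Real.toNNReal (a ^ (N - 1)) • (a ^ k * f a),
        setIntegral_congr_fun measurableSet_Ioi fun x hx => ?_]
      · rw [NNReal.smul_def, Real.coe_toNNReal _ (pow_nonneg (le_of_lt hx) _), pow_add, smul_eq_mul]
        ring
      · exact (measurable_subtype_coe.pow_const _).real_toNNReal

theorem hasDerivAt_max_one_sub_sq (s : ℝ) :
    HasDerivAt (fun s : ℝ => max (1 - s) 0 ^ 2) (-2 * max (1 - s) 0) s := by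
  rcases lt_trichotomy s 1 with h | rfl | h
  · rw [max_eq_left (by linarith)]
    have h1 : HasDerivAt (fun s : ℝ => (1 - s) ^ 2) (-2 * (1 - s)) s := by
      have := ((hasDerivAt_id s).const_sub 1).pow 2
      refine this.congr_deriv ?_
      simp
    refine h1.congr_of_eventuallyEq ?_
    filter_upwards [Iio_mem_nhds h] with y hy
    rw [max_eq_left (by linarith [mem_Iio.1 hy])]
  · rw [hasDerivAt_iff_isLittleO]
    have h2 : (fun x : ℝ => (x - 1) ^ 2) =o[𝓝 1] fun x => x - 1 := by
      have h3 : Tendsto (fun x : ℝ => x - 1) (𝓝 1) (𝓝 0) := by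
        have : Continuous fun x : ℝ => x - 1 := by fun_prop
        simpa using this.tendsto 1
      exact (Asymptotics.isLittleO_pow_id one_lt_two).comp_tendsto h3
    refine Asymptotics.IsBigO.trans_isLittleO ?_ h2
    refine Asymptotics.IsBigO.of_bound 1 (Eventually.of_forall fun x => ?_)
    rcases le_total (1 - x) 0 with hx | hx
    · simp [max_eq_right hx, sq_nonneg]
    · simp [max_eq_left hx, abs_sub_comm]
  · rw [max_eq_right (by linarith), mul_zero]
    refine (hasDerivAt_const s (0 : ℝ)).congr_of_eventuallyEq ?_
    filter_upwards [Ioi_mem_nhds h] with y hy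
    rw [max_eq_right (by linarith [mem_Ioi.1 hy])]
    simp

/-- The compactly supported radial weight `(1 - |z|²)₊`. -/
def ballWeight (z : EuclideanSpace ℝ (Fin N)) : ℝ := max (1 - ‖z‖ ^ 2) 0

theorem continuous_ballWeight : Continuous (ballWeight (N := N)) := by
  unfold ballWeight; fun_prop

theorem continuous_ballWeight_sq :
    Continuous fun z : EuclideanSpace ℝ (Fin N) => ballWeight z ^ 2 :=
  continuous_ballWeight.pow 2

theorem ballWeight_zero : ballWeight (0 : EuclideanSpace ℝ (Fin N)) = 1 := by simp [ballWeight]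

theorem hasCompactSupport_ballWeight : HasCompactSupport (ballWeight (N := N)) := by
  refine HasCompactSupport.intro (isCompact_closedBall 0 1) fun z hz => ?_
  rw [mem_closedBall_zero_iff, not_le] at hz
  exact max_eq_right (by nlinarith)

theorem hasFDerivAt_ballWeight_sq (z : EuclideanSpace ℝ (Fin N)) :
    HasFDerivAt (fun z => ballWeight z ^ 2) ((-4 * ballWeight z) • innerSL ℝ z) z := by
  have h := (hasDerivAt_max_one_sub_sq (‖z‖ ^ 2)).comp_hasFDerivAt z
    (hasStrictFDerivAt_norm_sq z).hasFDerivAt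
  refine h.congr_fderiv ?_
  rw [two_smul ℕ, ← two_smul ℝ, smul_smul]
  congr 1
  simp only [ballWeight]; ring

theorem integrable_eval_mul {g : EuclideanSpace ℝ (Fin N) → ℝ} (hg : Continuous g)
    (hg' : HasCompactSupport g) (P : MvPolynomial (Fin N) ℝ) :
    Integrable fun z : EuclideanSpace ℝ (Fin N) => eval (fun i => z i) P * g z :=
  ((continuous_eval_euclidean P).mul hg).integrable_of_hasCompactSupport hg'.mul_left

theorem hasCompactSupport_ballWeight_sq :
    HasCompactSupport fun z : EuclideanSpace ℝ (Fin N) => ballWeight z ^ 2 :=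
  hasCompactSupport_ballWeight.comp_left (g := fun t : ℝ => t ^ 2) (by simp)

theorem integral_eval_pderiv_mul_ballWeight_sq (P : MvPolynomial (Fin N) ℝ) (i : Fin N) :
    ∫ z : EuclideanSpace ℝ (Fin N), eval (fun i => z i) (pderiv i P) * ballWeight z ^ 2 =
      4 * ∫ z : EuclideanSpace ℝ (Fin N), eval (fun i => z i) (X i * P) * ballWeight z := by
  have hw : ∀ z : EuclideanSpace ℝ (Fin N),
      fderiv ℝ (fun z => ballWeight z ^ 2) z (EuclideanSpace.single i 1) =
        -4 * ballWeight z * z i := fun z => by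
    rw [(hasFDerivAt_ballWeight_sq z).fderiv]
    simp [EuclideanSpace.inner_single_right]
  have h := integral_mul_fderiv_eq_neg_fderiv_mul_of_integrable
    (μ := (volume : Measure (EuclideanSpace ℝ (Fin N))))
    (f := fun z : EuclideanSpace ℝ (Fin N) => eval (fun i => z i) P)
    (g := fun z => ballWeight z ^ 2) (v := EuclideanSpace.single i 1)
    (by
      simp only [fderiv_eval_single]
      exact integrable_eval_mul continuous_ballWeight_sq hasCompactSupport_ballWeight_sq _)
    (by
      refine ((integrable_eval_mul continuous_ballWeight hasCompactSupport_ballWeight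
        (X i * P)).const_mul (-4)).congr (Eventually.of_forall fun z => ?_)
      simp only [hw, map_mul, eval_X]
      ring)
    (integrable_eval_mul continuous_ballWeight_sq hasCompactSupport_ballWeight_sq _)
    (fun z _ => (hasFDerivAt_eval P z).differentiableAt)
    (fun z _ => (hasFDerivAt_ballWeight_sq z).differentiableAt)
  simp only [fderiv_eval_single] at h
  rw [← neg_eq_iff_eq_neg] at h
  rw [← h, ← integral_neg, ← integral_const_mul]
  refine integral_congr_ae (Eventually.of_forall fun z => ?_)
  simp only [hw, map_mul, eval_X]
  ring

theorem IsHomogeneous.integral_eval_laplacian {P : MvPolynomial (Fin N) ℝ} {k : ℕ}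
    (hP : P.IsHomogeneous k) :
    ∫ z : EuclideanSpace ℝ (Fin N), eval (fun i => z i) (laplacian P) * ballWeight z ^ 2 =
      4 * k * ∫ z : EuclideanSpace ℝ (Fin N), eval (fun i => z i) P * ballWeight z := by
  simp only [laplacian, map_sum, Finset.sum_mul]
  rw [integral_finsetSum _ fun i _ => integrable_eval_mul continuous_ballWeight_sq
    hasCompactSupport_ballWeight_sq _]
  simp only [integral_eval_pderiv_mul_ballWeight_sq]
  have h : ∀ z : EuclideanSpace ℝ (Fin N), ∑ i, eval (fun i => z i) (X i * pderiv i P) *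
      ballWeight z = k * (eval (fun i => z i) P * ballWeight z) := fun z => by
    rw [← Finset.sum_mul, ← map_sum, hP.sum_X_mul_pderiv]
    simp [mul_assoc]
  rw [← Finset.mul_sum, mul_assoc, ← integral_const_mul]
  simp only [← h]
  rw [integral_finsetSum _ fun i _ => integrable_eval_mul continuous_ballWeight
    hasCompactSupport_ballWeight _]

theorem IsHomogeneous.integral_eval_mul_ballWeight (hN : N ≠ 0) {P : MvPolynomial (Fin N) ℝ}
    {k : ℕ} (hP : P.IsHomogeneous k) :
    ∫ z : EuclideanSpace ℝ (Fin N), eval (fun i => z i) P * ballWeight z =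
      sphereIntegral P * ∫ t in Ioi (0 : ℝ), max (1 - t ^ 2) 0 * t ^ (N - 1 + k) :=
  hP.integral_eval_mul_norm hN fun t => max (1 - t ^ 2) 0

theorem integral_max_one_sub_sq_mul_pow_pos (n : ℕ) :
    0 < ∫ t in Ioi (0 : ℝ), max (1 - t ^ 2) 0 * t ^ n := by
  have h : ∀ t ∈ Ioi (0 : ℝ), t ∉ Ioc (0 : ℝ) 1 → max (1 - t ^ 2) 0 * t ^ n = 0 := by
    intro t ht ht'
    have : 1 < t := by
      by_contra hc
      exact ht' ⟨ht, not_lt.1 hc⟩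
    rw [max_eq_right (by nlinarith), zero_mul]
  rw [setIntegral_eq_of_subset_of_forall_sdiff_eq_zero measurableSet_Ioi Ioc_subset_Ioi_self
    fun t ht => h t ht.1 ht.2, ← intervalIntegral.integral_of_le zero_le_one]
  refine intervalIntegral.intervalIntegral_pos_of_pos_on
    (Continuous.intervalIntegrable (by fun_prop) _ _) (fun t ht => ?_) one_pos
  have h1 : 0 < 1 - t ^ 2 := by nlinarith [ht.1, ht.2]
  exact mul_pos (lt_max_of_lt_left h1) (pow_pos ht.1 n)

theorem IsHomogeneous.sphereIntegral_eq_zero (hN : N ≠ 0) {P : MvPolynomial (Fin N) ℝ}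
    {k : ℕ} (hP : P.IsHomogeneous k) (hk : k ≠ 0) (hΔ : laplacian P = 0) :
    sphereIntegral P = 0 := by
  have h := hP.integral_eval_laplacian
  rw [hΔ, hP.integral_eval_mul_ballWeight hN] at h
  have hG := integral_max_one_sub_sq_mul_pow_pos (N - 1 + k)
  have hk' : (k : ℝ) ≠ 0 := Nat.cast_ne_zero.2 hk
  simpa [hk', hG.ne'] using h.symm

theorem IsHomogeneous.laplacian_eq_zero_of_sphereIntegral (hN : N ≠ 0)
    {P : MvPolynomial (Fin N) ℝ} (hP : P.IsHomogeneous 2) {a : ℝ} (ha : laplacian P = C a)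
    (hS : sphereIntegral P = 0) : a = 0 := by
  have h := hP.integral_eval_laplacian
  rw [ha, hP.integral_eval_mul_ballWeight hN, hS] at h
  have hpos : 0 < ∫ z : EuclideanSpace ℝ (Fin N), ballWeight z ^ 2 :=
    continuous_ballWeight_sq.integral_pos_of_hasCompactSupport_nonneg_nonzero
      hasCompactSupport_ballWeight_sq (fun z => sq_nonneg _) (x := 0)
      (by simp [ballWeight_zero])
  simp only [eval_C, integral_const_mul, zero_mul, mul_zero] at h
  exact (mul_eq_zero.1 h).resolve_right hpos.ne'

end MvPolynomial

section Kernel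

variable {N m : ℕ} {K : ℝ → ℝ}

/-- The truncated moment `∫_ε^{1/ε} K(t) t^{N-1+k} dt`. -/
def kernelMoment (N : ℕ) (K : ℝ → ℝ) (k : ℕ) (ε : ℝ) : ℝ :=
  ∫ t in Ioo ε (1 / ε), K t * t ^ ((N : ℝ) - 1 + (k : ℝ))

theorem measurableSet_annulus (ε : ℝ) : MeasurableSet (annulus N ε) :=
  (measurableSet_lt measurable_const measurable_norm).inter
    (measurableSet_lt measurable_norm measurable_const)

theorem integrableOn_eval_mul_annulus (hK : ContinuousOn K (Ioi 0))
    (P : MvPolynomial (Fin N) ℝ) {ε : ℝ} (hε : 0 < ε) :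
    IntegrableOn (fun z : EuclideanSpace ℝ (Fin N) =>
      MvPolynomial.eval (fun i => z i) P * K ‖z‖) (annulus N ε) := by
  have hc : IsCompact {z : EuclideanSpace ℝ (Fin N) | ε ≤ ‖z‖ ∧ ‖z‖ ≤ 1 / ε} := by
    refine (isCompact_closedBall (0 : EuclideanSpace ℝ (Fin N)) (1 / ε)).of_isClosed_subset
      ((isClosed_le continuous_const continuous_norm).inter
        (isClosed_le continuous_norm continuous_const)) fun z hz => ?_
    exact mem_closedBall_zero_iff.2 hz.2
  have hf : ContinuousOn (fun z : EuclideanSpace ℝ (Fin N) =>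
      MvPolynomial.eval (fun i => z i) P * K ‖z‖) {z | ε ≤ ‖z‖ ∧ ‖z‖ ≤ 1 / ε} :=
    (MvPolynomial.continuous_eval_euclidean P).continuousOn.mul
      (hK.comp continuous_norm.continuousOn fun z hz => hε.trans_le hz.1)
  exact (hf.integrableOn_compact hc).mono_set fun z hz => ⟨hz.1.le, hz.2.le⟩

theorem MvPolynomial.IsHomogeneous.integral_annulus (hN : N ≠ 0) {P : MvPolynomial (Fin N) ℝ}
    {k : ℕ} (hP : P.IsHomogeneous k) (K : ℝ → ℝ) {ε : ℝ} (hε : 0 < ε) :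
    ∫ z in annulus N ε, MvPolynomial.eval (fun i => z i) P * K ‖z‖ =
      P.sphereIntegral * kernelMoment N K k ε := by
  rw [← integral_indicator (measurableSet_annulus ε)]
  have h := hP.integral_eval_mul_norm hN ((Ioo ε (1 / ε)).indicator K)
  have h1 : ∀ z : EuclideanSpace ℝ (Fin N), (annulus N ε).indicator
      (fun z => MvPolynomial.eval (fun i => z i) P * K ‖z‖) z =
      MvPolynomial.eval (fun i => z i) P * (Ioo ε (1 / ε)).indicator K ‖z‖ := fun z => by
    by_cases hz : z ∈ annulus N ε
    · rw [indicator_of_mem hz, indicator_of_mem (show ‖z‖ ∈ Ioo ε (1 / ε) from hz)]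
    · rw [indicator_of_notMem hz, indicator_of_notMem (show ‖z‖ ∉ Ioo ε (1 / ε) from hz), mul_zero]
  simp only [h1]
  rw [h, kernelMoment]
  congr 1
  have hsub : Ioo ε (1 / ε) ⊆ Ioi 0 := fun t ht => hε.trans ht.1
  rw [setIntegral_eq_of_subset_of_forall_sdiff_eq_zero measurableSet_Ioi hsub
    fun t ht => by rw [indicator_of_notMem ht.2, zero_mul]]
  refine setIntegral_congr_fun measurableSet_Ioo fun t ht => ?_
  have hexp : (N : ℝ) - 1 + k = ((N - 1 + k : ℕ) : ℝ) := by
    push_cast [Nat.one_le_iff_ne_zero.2 hN]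
    ring
  simp only [indicator_of_mem ht, hexp, Real.rpow_natCast]

theorem MvPolynomial.IsHomogeneous.eval_sub_eval_add {P : MvPolynomial (Fin N) ℝ}
    (hP : P.IsHomogeneous m) (x z : Fin N → ℝ) :
    eval x P - eval (x + z) P =
      -∑ k ∈ Finset.range m, eval z (homogeneousComponent (k + 1) (translate x P)) := by
  have hdeg : (translate x P).totalDegree ≤ m :=
    (totalDegree_translate_le x P).trans hP.totalDegree_le
  have hsum : ∑ k ∈ Finset.range (m + 1), homogeneousComponent k (translate x P) =
      translate x P := by
    conv_rhs => rw [← sum_homogeneousComponent (translate x P)]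
    refine (Finset.sum_subset (Finset.range_subset_range.2 (by lia)) fun k _ hk => ?_).symm
    exact homogeneousComponent_eq_zero _ _ (by simpa using hk)
  have heval : eval z (translate x P) = ∑ k ∈ Finset.range m,
      eval z (homogeneousComponent (k + 1) (translate x P)) + eval x P := by
    conv_lhs => rw [← hsum, Finset.sum_range_succ', homogeneousComponent_zero,
      coeff_zero_translate, map_add, map_sum, eval_C]
  rw [← eval_translate, heval]
  ring

theorem pvIntK_eval (hN : N ≠ 0) (hK : ContinuousOn K (Ioi 0)) {P : MvPolynomial (Fin N) ℝ}
    (hP : P.IsHomogeneous m) (x : EuclideanSpace ℝ (Fin N)) {ε : ℝ} (hε : 0 < ε) :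
    pvIntK N K (fun y => MvPolynomial.eval (fun i => y i) P) x ε =
      -∑ k ∈ Finset.range m, (MvPolynomial.homogeneousComponent (k + 1)
        (MvPolynomial.translate (fun i => x i) P)).sphereIntegral * kernelMoment N K (k + 1) ε := by
  have h : ∀ z : EuclideanSpace ℝ (Fin N), MvPolynomial.eval (fun i => x i) P -
      MvPolynomial.eval (fun i => (x + z) i) P = _ := fun z =>
    hP.eval_sub_eval_add (fun i => x i) (fun i => z i)
  simp only [pvIntK, h, neg_mul, Finset.sum_mul]
  rw [integral_neg, integral_finsetSum _ fun k _ => integrableOn_eval_mul_annulus hK _ hε]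
  simp only [(MvPolynomial.homogeneousComponent_isHomogeneous _ _).integral_annulus hN K hε]

theorem eventually_le_kernelMoment (hK : ContinuousOn K (Ioi 0))
    (hKpos : ∀ t ∈ Ioi (0 : ℝ), 0 ≤ K t) (k : ℕ)
    (hKint : 0 < ∫⁻ t in Ioi (0 : ℝ), ENNReal.ofReal (K t * t ^ ((N : ℝ) - 1 + (k : ℝ)))) :
    ∃ c > 0, ∀ᶠ ε in 𝓝[>] (0 : ℝ), c ≤ kernelMoment N K k ε := by
  have hc : ContinuousOn (fun t => K t * t ^ ((N : ℝ) - 1 + (k : ℝ))) (Ioi 0) :=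
    hK.mul fun t ht => (Real.continuousAt_rpow_const t _ (Or.inl (ne_of_gt ht))).continuousWithinAt
  have hnn : ∀ t ∈ Ioi (0 : ℝ), 0 ≤ K t * t ^ ((N : ℝ) - 1 + (k : ℝ)) := fun t ht =>
    mul_nonneg (hKpos t ht) (Real.rpow_nonneg (le_of_lt ht) _)
  obtain ⟨t, ht, hpos⟩ : ∃ t ∈ Ioi (0 : ℝ), 0 < K t * t ^ ((N : ℝ) - 1 + (k : ℝ)) := by
    by_contra! hcon
    refine hKint.ne' ?_
    rw [setLIntegral_congr_fun (g := fun _ => 0) measurableSet_Ioi fun t ht =>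
      ENNReal.ofReal_of_nonpos (hcon t ht)]
    simp
  rw [mem_Ioi] at ht
  obtain ⟨δ, hδ, hδt, hδt'⟩ : ∃ δ : ℝ, 0 < δ ∧ δ < t ∧ t < 1 / δ := by
    refine ⟨min t (1 / t) / 2, by positivity, ?_, ?_⟩
    · linarith [min_le_left t (1 / t)]
    · rw [lt_div_iff₀ (by positivity)]
      have h1 : t * min t (1 / t) ≤ 1 := by
        calc t * min t (1 / t) ≤ t * (1 / t) := by gcongr; exact min_le_right _ _
          _ = 1 := by field_simp
      linarith
  have hint : ∀ {ε : ℝ}, 0 < ε →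
      IntegrableOn (fun t => K t * t ^ ((N : ℝ) - 1 + (k : ℝ))) (Ioo ε (1 / ε)) := fun hε =>
    ((hc.mono fun s hs => hε.trans_le hs.1).integrableOn_compact isCompact_Icc).mono_set
      Ioo_subset_Icc_self
  refine ⟨kernelMoment N K k δ, ?_, ?_⟩
  · rw [kernelMoment, ← integral_Ioc_eq_integral_Ioo,
      ← intervalIntegral.integral_of_le (hδt.trans hδt').le]
    exact intervalIntegral.integral_pos (hδt.trans hδt') (hc.mono fun s hs => hδ.trans_le hs.1)
      (fun s hs => hnn s (hδ.trans hs.1)) ⟨t, ⟨hδt.le, hδt'.le⟩, hpos⟩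
  · filter_upwards [Ioo_mem_nhdsGT hδ] with ε hε
    refine setIntegral_mono_set (hint hε.1) ?_ (Ioo_subset_Ioo hε.2.le
      (one_div_le_one_div_of_le hε.1 hε.2.le)).eventuallyLE
    filter_upwards [ae_restrict_mem measurableSet_Ioo] with s hs
    exact hnn s (hε.1.trans hs.1)

end Kernel

/-- If a linear combination of positive functions, each negligible with respect to those of higher
index and bounded away from zero, tends to zero, then all its coefficients vanish. -/
theorem coeff_eq_zero_of_tendsto_sum {l : Filter ℝ} [l.NeBot] {m : ℕ} {A : ℕ → ℝ → ℝ} {S : ℕ → ℝ}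
    (hA : ∀ i ∈ Finset.Icc 2 m, ∃ c > 0, ∀ᶠ ε in l, c ≤ A i ε)
    (hratio : ∀ i ∈ Finset.Icc 2 m, ∀ j ∈ Finset.Icc 2 m, j < i →
      Tendsto (fun ε => A j ε / A i ε) l (𝓝 0))
    (hS : S 1 = 0)
    (hsum : Tendsto (fun ε => ∑ k ∈ Finset.range m, S (k + 1) * A (k + 1) ε) l (𝓝 0)) :
    ∀ k ∈ Finset.Icc 2 m, S k = 0 := by
  by_contra! hcon
  obtain ⟨k₀, hk₀, hSk₀⟩ := hcon
  obtain ⟨k, hk, hmax⟩ := ((Finset.Icc 2 m).filter fun k => S k ≠ 0).exists_max_image id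
    ⟨k₀, Finset.mem_filter.2 ⟨hk₀, hSk₀⟩⟩
  obtain ⟨hkm, hSk⟩ := Finset.mem_filter.1 hk
  obtain ⟨c, hc, hAc⟩ := hA k hkm
  have h0 : Tendsto (fun ε => (∑ j ∈ Finset.range m, S (j + 1) * A (j + 1) ε) / A k ε) l
      (𝓝 0) := by
    refine squeeze_zero_norm' (a := fun ε => |∑ j ∈ Finset.range m, S (j + 1) * A (j + 1) ε| / c)
      ?_ (by simpa using hsum.abs.div_const c)
    filter_upwards [hAc] with ε hε
    rw [Real.norm_eq_abs, abs_div, abs_of_pos (hc.trans_le hε)]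
    gcongr
  have h1 : Tendsto (fun ε => ∑ j ∈ Finset.range m, S (j + 1) * (A (j + 1) ε / A k ε)) l
      (𝓝 (∑ j ∈ Finset.range m, if j + 1 = k then S k else 0)) := by
    refine tendsto_finsetSum _ fun j hj => ?_
    rw [Finset.mem_range] at hj
    split_ifs with hjk
    · subst hjk
      refine tendsto_const_nhds.congr' ?_
      filter_upwards [hAc] with ε hε
      rw [div_self (hc.trans_le hε).ne', mul_one]
    · by_cases hz : S (j + 1) = 0
      · simp [hz]
      have hj1 : j + 1 ≠ 1 := fun h => hz (by rw [h, hS])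
      have hjm : j + 1 ∈ Finset.Icc 2 m := Finset.mem_Icc.2 ⟨by lia, by lia⟩
      have hle : j + 1 ≤ k := hmax _ (Finset.mem_filter.2 ⟨hjm, hz⟩)
      simpa using (hratio k hkm _ hjm (lt_of_le_of_ne hle hjk)).const_mul (S (j + 1))
  have h2 : ∑ j ∈ Finset.range m, (if j + 1 = k then S k else 0) = S k := by
    rw [Finset.mem_Icc] at hkm
    rw [Finset.sum_eq_single_of_mem (k - 1) (Finset.mem_range.2 (by lia))
      fun j _ hj => if_neg (by lia), if_pos (by lia)]
  rw [h2] at h1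
  refine hSk (tendsto_nhds_unique h1 (h0.congr fun ε => ?_))
  rw [Finset.sum_div]
  exact Finset.sum_congr rfl fun j _ => mul_div_assoc _ _ _

/-- If `K` is a continuous nonnegative kernel on `(0,∞)` with
`∫_0^∞ K(t) t^{N-1+i} dt ∈ (0,∞]` for `i = 2,…,m`, and the ratios
`κ_{i,j}(ε) = (∫_ε^{1/ε} K t^{N-1+j})/(∫_ε^{1/ε} K t^{N-1+i})` tend to `0` as `ε → 0⁺`
whenever `i > j` (`i,j ∈ {2,…,m}`), then `ℋ_m^K(ℝ^N) = ℋ_m^1(ℝ^N)`. -/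
theorem HK_eq_H1_of_ratio_gt
    (N : ℕ) (hN : 2 ≤ N) (m : ℕ) (hm : 2 ≤ m) (K : ℝ → ℝ)
    (hK : ContinuousOn K (Ioi 0)) (hKpos : ∀ t ∈ Ioi (0 : ℝ), 0 ≤ K t)
    (hKint : ∀ i ∈ Finset.Icc 2 m,
      0 < ∫⁻ t in Ioi (0 : ℝ), ENNReal.ofReal (K t * t ^ ((N : ℝ) - 1 + (i : ℝ))))
    (hratio : ∀ i ∈ Finset.Icc 2 m, ∀ j ∈ Finset.Icc 2 m, j < i →
      Tendsto (fun ε : ℝ =>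
          (∫ t in Ioo ε (1 / ε), K t * t ^ ((N : ℝ) - 1 + (j : ℝ))) /
          (∫ t in Ioo ε (1 / ε), K t * t ^ ((N : ℝ) - 1 + (i : ℝ))))
        (𝓝[>] (0 : ℝ)) (𝓝 0)) :
    HK N K m = H1 N m := by
  have hN' : N ≠ 0 := by lia
  ext u
  refine and_congr_right fun ⟨P, hP, hu⟩ => ?_
  obtain rfl : u = fun y => MvPolynomial.eval (fun i => y i) P := funext hu
  simp only [MvPolynomial.lap_eval]
  constructor
  · intro h x
    have hx := (h x).neg
    rw [neg_zero] at hx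
    have hS := coeff_eq_zero_of_tendsto_sum (A := kernelMoment N K)
      (S := fun k => (MvPolynomial.homogeneousComponent k
        (MvPolynomial.translate (fun i => x i) P)).sphereIntegral)
      (fun i hi => eventually_le_kernelMoment hK hKpos i (hKint i hi)) hratio
      ((MvPolynomial.homogeneousComponent_isHomogeneous 1 _).sphereIntegral_eq_zero hN' one_ne_zero
        (MvPolynomial.homogeneousComponent_isHomogeneous 1 _).laplacian_eq_zero)
      (hx.congr' (by
        filter_upwards [self_mem_nhdsWithin] with ε hε
        rw [pvIntK_eval hN' hK hP x hε, neg_neg]))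
      2 (Finset.mem_Icc.2 ⟨le_rfl, hm⟩)
    refine (MvPolynomial.homogeneousComponent_isHomogeneous 2
      _).laplacian_eq_zero_of_sphereIntegral hN' ?_ hS
    rw [← MvPolynomial.homogeneousComponent_laplacian 0, MvPolynomial.laplacian_translate,
      MvPolynomial.homogeneousComponent_zero, MvPolynomial.coeff_zero_translate]
  · intro h x
    have hΔ : MvPolynomial.laplacian P = 0 := MvPolynomial.funext fun y => by
      simpa using h (WithLp.toLp 2 y)
    have hS : ∀ k, (MvPolynomial.homogeneousComponent (k + 1)
        (MvPolynomial.translate (fun i => x i) P)).sphereIntegral = 0 := fun k => by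
      refine (MvPolynomial.homogeneousComponent_isHomogeneous (k + 1) _).sphereIntegral_eq_zero
        hN' k.succ_ne_zero ?_
      cases k with
      | zero => exact (MvPolynomial.homogeneousComponent_isHomogeneous 1 _).laplacian_eq_zero
      | succ k =>
        rw [← MvPolynomial.homogeneousComponent_laplacian, MvPolynomial.laplacian_translate, hΔ,
          map_zero, map_zero]
    refine tendsto_const_nhds.congr' ?_
    filter_upwards [self_mem_nhdsWithin] with ε hε
    simp [pvIntK_eval hN' hK hP x hε, hS]
end
end
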